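/- Let G be a strictly chordal graph and S a minimal vertex separator of G. Then ω(G−S), the number of connected components of G−S, equals the number of maximal cliques of G that contain S. -/

import Mathlib

open SimpleGraph

variable {V : Type*}

noncomputable def numComp (G : SimpleGraph V) (S : Set V) : ℕ :=
  Nat.card (G.induce Sᶜ).ConnectedComponent

def SeparatedBy (G : SimpleGraph V) (S : Set V) (u v : V) : Prop :=
  ∃ (hu : u ∈ Sᶜ) (hv : v ∈ Sᶜ), ¬ (G.induce Sᶜ).Reachable ⟨u, hu⟩ ⟨v, hv⟩

def IsSeparator (G : SimpleGraph V) (S : Set V) : Prop :=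
  ∃ u v, G.Reachable u v ∧ SeparatedBy G S u v

def IsMinimalSeparator (G : SimpleGraph V) (S : Set V) : Prop :=
  IsSeparator G S ∧ ∀ T ⊂ S, ¬ IsSeparator G T

def IsMVS (G : SimpleGraph V) (S : Set V) : Prop :=
  ∃ u v, u ≠ v ∧ ¬ G.Adj u v ∧ SeparatedBy G S u v ∧ ∀ T ⊂ S, ¬ SeparatedBy G T u v

def IsChordal (G : SimpleGraph V) : Prop :=
  ∀ n, 4 ≤ n → IsEmpty (cycleGraph n ↪g G)

def StrictlyChordal (G : SimpleGraph V) : Prop :=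
  G.Connected ∧ IsChordal G ∧
    ∀ S S' : Set V, IsMVS G S → IsMVS G S' → S ≠ S' → Disjoint S S'

noncomputable def sc [Finite V] (G : SimpleGraph V) : ℤ :=
  sSup {k : ℤ | ∃ S : Set V, numComp G S ≠ 1 ∧ k = (numComp G S : ℤ) - (Nat.card S : ℤ)}

noncomputable def toughness [Finite V] (G : SimpleGraph V) : ℝ :=
  sInf {t : ℝ | ∃ S : Set V, 1 < numComp G S ∧ t = (Nat.card S : ℝ) / (numComp G S : ℝ)}

def IsScatteringSet [Finite V] (G : SimpleGraph V) (S : Set V) : Prop :=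
  numComp G S ≠ 1 ∧ (numComp G S : ℤ) - (Nat.card S : ℤ) = sc G

def IsMaxClique (G : SimpleGraph V) (Q : Set V) : Prop :=
  G.IsClique Q ∧ ∀ R : Set V, G.IsClique R → Q ⊆ R → Q = R

def IsSimplicial (G : SimpleGraph V) (v : V) : Prop :=
  G.IsClique (G.neighborSet v)

def IsBoundaryClique (G : SimpleGraph V) (Q : Set V) : Prop :=
  IsMaxClique G Q ∧ (∃ v ∈ Q, IsSimplicial G v) ∧
    ∃ Q' : Set V, IsMaxClique G Q' ∧ Q' ≠ Q ∧ Q ∩ Q' = {v | v ∈ Q ∧ ¬ IsSimplicial G v}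

def BS (G : SimpleGraph V) (S : Set V) : Set (Set V) :=
  {Q | IsBoundaryClique G Q ∧ S ⊆ Q}

theorem separatedBy_compl_pair {G : SimpleGraph V} {x y : V} (hne : x ≠ y) (hadj : ¬ G.Adj x y) :
    SeparatedBy G ({x, y}ᶜ) x y := by
  refine ⟨by simp, by simp, fun h => ?_⟩
  obtain ⟨p⟩ := h
  cases p with
  | nil => exact hne rfl
  | cons h q =>
    rename_i w
    have hw : G.Adj x w.1 := h
    have hmem := w.2
    simp only [compl_compl, Set.mem_insert_iff, Set.mem_singleton_iff] at hmem
    rcases hmem with hx | hy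
    · rw [hx] at hw
      exact hw.ne rfl
    · rw [hy] at hw
      exact hadj hw

theorem exists_isMVS_separatedBy [Finite V] {G : SimpleGraph V} {x y : V} (hne : x ≠ y)
    (hadj : ¬ G.Adj x y) : ∃ T, IsMVS G T ∧ SeparatedBy G T x y := by
  obtain ⟨T, -, hT⟩ :=
    exists_minimal_le_of_wellFoundedLT (fun T => SeparatedBy G T x y) _
      (separatedBy_compl_pair hne hadj)
  exact ⟨T, ⟨x, y, hne, hadj, hT.prop, fun R hR => hT.not_prop_of_lt hR⟩, hT.prop⟩

theorem SeparatedBy.mem_of_adj {G : SimpleGraph V} {T : Set V} {x y w : V}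
    (h : SeparatedBy G T x y) (hx : G.Adj x w) (hy : G.Adj w y) : w ∈ T := by
  obtain ⟨hxT, hyT, hr⟩ := h
  by_contra hw
  have h1 : (G.induce Tᶜ).Adj ⟨x, hxT⟩ ⟨w, hw⟩ := hx
  have h2 : (G.induce Tᶜ).Adj ⟨w, hw⟩ ⟨y, hyT⟩ := hy
  exact hr (h1.reachable.trans h2.reachable)

theorem StrictlyChordal.separatedBy_of_adj [Finite V] {G : SimpleGraph V} (hG : StrictlyChordal G)
    {S : Set V} (hS : IsMVS G S) {x y w : V} (hne : x ≠ y) (hadj : ¬ G.Adj x y) (hw : w ∈ S)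
    (hx : G.Adj x w) (hy : G.Adj w y) : SeparatedBy G S x y := by
  obtain ⟨T, hT, hsep⟩ := exists_isMVS_separatedBy hne hadj
  rcases eq_or_ne S T with rfl | hST
  · exact hsep
  · exact absurd (hsep.mem_of_adj hx hy) (Set.disjoint_left.mp (hG.2.2 S T hS hT hST) hw)

theorem exists_reachable_adj_of_walk {G : SimpleGraph V} {S : Set V} {c s : V} (p : G.Walk c s)
    (hs : s ∈ S) (hc : c ∈ Sᶜ) :
    ∃ d : (Sᶜ : Set V), (G.induce Sᶜ).Reachable ⟨c, hc⟩ d ∧ ∃ t ∈ S, G.Adj d t := by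
  induction p with
  | nil => exact absurd hs hc
  | @cons a b _ h q ih =>
    by_cases hb : b ∈ S
    · exact ⟨⟨a, hc⟩, .rfl, b, hb, h⟩
    · obtain ⟨d, hd, ht⟩ := ih hs hb
      have hab : (G.induce Sᶜ).Adj ⟨a, hc⟩ ⟨b, hb⟩ := h
      exact ⟨d, hab.reachable.trans hd, ht⟩

theorem IsMVS.nonempty {G : SimpleGraph V} (hG : G.Connected) {S : Set V} (hS : IsMVS G S) :
    S.Nonempty := by
  obtain ⟨u, v, -, -, ⟨hu, hv, hr⟩, -⟩ := hS
  by_contra hne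
  obtain rfl := Set.not_nonempty_iff_eq_empty.mp hne
  obtain ⟨p⟩ := hG.preconnected u v
  exact hr ⟨p.induce _ (by simp)⟩

theorem SeparatedBy.symm {G : SimpleGraph V} {S : Set V} {u v : V} (h : SeparatedBy G S u v) :
    SeparatedBy G S v u := by
  obtain ⟨hu, hv, hr⟩ := h
  exact ⟨hv, hu, fun h => hr h.symm⟩

/-- The vertices outside `S` that are reachable from `u` in `G - S`. -/
def componentAvoiding (G : SimpleGraph V) (S : Set V) (u : V) : Set V :=
  {w | ∃ (hu : u ∈ Sᶜ) (hw : w ∈ Sᶜ), (G.induce Sᶜ).Reachable ⟨u, hu⟩ ⟨w, hw⟩}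

theorem mem_componentAvoiding_of_adj {G : SimpleGraph V} {S : Set V} {u x y : V}
    (hx : x ∈ componentAvoiding G S u) (hy : y ∉ S) (h : G.Adj x y) :
    y ∈ componentAvoiding G S u := by
  obtain ⟨hu, hxS, hr⟩ := hx
  have hxy : (G.induce Sᶜ).Adj ⟨x, hxS⟩ ⟨y, hy⟩ := h
  exact ⟨hu, hy, hr.trans hxy.reachable⟩

theorem exists_adj_mem_componentAvoiding {G : SimpleGraph V} {S : Set V} {u v s : V}
    (hsep : SeparatedBy G S u v) (hmin : ∀ T ⊂ S, ¬ SeparatedBy G T u v) (hs : s ∈ S) :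
    ∃ d ∈ componentAvoiding G S u, G.Adj d s := by
  by_contra! hno
  obtain ⟨hu, hv, hr⟩ := hsep
  refine hmin (S \ {s}) (Set.sdiff_singleton_ssubset.mpr hs)
    ⟨fun h => hu h.1, fun h => hv h.1, fun ⟨p⟩ => ?_⟩
  have key : ∀ (x y : ((S \ {s})ᶜ : Set V)), (G.induce (S \ {s})ᶜ).Walk x y →
      x.1 ∈ componentAvoiding G S u → y.1 ∈ componentAvoiding G S u := by
    intro x y p
    induction p with
    | nil => exact id
    | @cons a b _ h _ ih =>
      intro ha
      have hab : G.Adj a.1 b.1 := h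
      refine ih (mem_componentAvoiding_of_adj ha (fun hb => ?_) hab)
      have hbs : b.1 = s := by
        by_contra hbs
        exact b.2 ⟨hb, hbs⟩
      rw [hbs] at hab
      exact hno a ha hab
  obtain ⟨_, _, h⟩ := key _ _ p ⟨hu, hu, .rfl⟩
  exact hr h

theorem reachable_induce_of_mem_componentAvoiding {G : SimpleGraph V} {S W : Set V} {u d : V}
    (hW : componentAvoiding G S u ⊆ W) (hd : d ∈ componentAvoiding G S u) (huW : u ∈ W) :
    (G.induce W).Reachable ⟨u, huW⟩ ⟨d, hW hd⟩ := by
  have key : ∀ (x y : (Sᶜ : Set V)), (G.induce Sᶜ).Walk x y →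
      ∀ (hx : x.1 ∈ componentAvoiding G S u) (hy : y.1 ∈ W),
        (G.induce W).Reachable ⟨x, hW hx⟩ ⟨y, hy⟩ := by
    intro x y p
    induction p with
    | nil => exact fun _ _ => .rfl
    | @cons a b _ h _ ih =>
      intro ha hy
      have hab : G.Adj a.1 b.1 := h
      have hb := mem_componentAvoiding_of_adj ha b.2 hab
      have hab' : (G.induce W).Adj ⟨a, hW ha⟩ ⟨b, hW hb⟩ := hab
      exact hab'.reachable.trans (ih hb hy)
  obtain ⟨hu, hdS, ⟨p⟩⟩ := hd
  exact key _ _ p ⟨hu, hu, .rfl⟩ _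

theorem SimpleGraph.Reachable.exists_induced_path {G : SimpleGraph V} {x y : V}
    (h : G.Reachable x y) : ∃ (p : ℕ) (f : ℕ → V), f 0 = x ∧ f p = y ∧
      ∀ i j, i < j → j ≤ p → f i ≠ f j ∧ (G.Adj (f i) (f j) ↔ j = i + 1) := by
  obtain ⟨p, hp⟩ := h.exists_walk_length_eq_dist
  have hdist : ∀ i ≤ p.length, G.dist x (p.getVert i) = i := by
    intro i hi
    have h1 := dist_le (p.take i)
    have h2 := dist_le (p.drop i)
    have h3 : G.dist x y ≤ G.dist x (p.getVert i) + G.dist (p.getVert i) y :=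
      (p.take i).reachable.dist_triangle_left _
    simp only [Walk.take_length, Walk.drop_length] at h1 h2
    omega
  refine ⟨p.length, p.getVert, by simp, by simp, fun i j hij hj => ⟨fun he => ?_, fun ha => ?_, ?_⟩⟩
  · have := hdist i (by omega)
    rw [he, hdist j hj] at this
    omega
  · have h3 : G.dist x (p.getVert j) ≤ G.dist x (p.getVert i) + G.dist (p.getVert i) (p.getVert j) :=
      (p.take i).reachable.dist_triangle_left _
    rw [hdist j hj, hdist i (by omega), dist_eq_one_iff_adj.mpr ha] at h3
    omega
  · rintro rfl
    exact p.adj_getVert_succ (by omega)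

theorem exists_induced_path_through_componentAvoiding {G : SimpleGraph V} {S : Set V}
    {u v s t : V} (hsep : SeparatedBy G S u v) (hmin : ∀ T ⊂ S, ¬ SeparatedBy G T u v)
    (hs : s ∈ S) (ht : t ∈ S) (hne : s ≠ t) (hadj : ¬ G.Adj s t) :
    ∃ (p : ℕ) (f : ℕ → V), 2 ≤ p ∧ f 0 = s ∧ f p = t ∧
      (∀ i, 0 < i → i < p → f i ∈ componentAvoiding G S u) ∧
      ∀ i j, i < j → j ≤ p → f i ≠ f j ∧ (G.Adj (f i) (f j) ↔ j = i + 1) := by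
  obtain ⟨d, hd, hds⟩ := exists_adj_mem_componentAvoiding hsep hmin hs
  obtain ⟨e, he, het⟩ := exists_adj_mem_componentAvoiding hsep hmin ht
  let W : Set V := componentAvoiding G S u ∪ {s, t}
  have hW : componentAvoiding G S u ⊆ W := Set.subset_union_left
  have hu : u ∈ componentAvoiding G S u := ⟨hsep.1, hsep.1, .rfl⟩
  have hsW : s ∈ W := by simp [W]
  have htW : t ∈ W := by simp [W]
  have h1 : (G.induce W).Adj ⟨d, hW hd⟩ ⟨s, hsW⟩ := hds
  have h2 : (G.induce W).Adj ⟨e, hW he⟩ ⟨t, htW⟩ := het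
  have hr : (G.induce W).Reachable ⟨s, hsW⟩ ⟨t, htW⟩ :=
    (h1.reachable.symm.trans
      (reachable_induce_of_mem_componentAvoiding hW hd (hW hu)).symm).trans
      ((reachable_induce_of_mem_componentAvoiding hW he (hW hu)).trans h2.reachable)
  obtain ⟨p, f, hf0, hfp, hf⟩ := hr.exists_induced_path
  have hp : 2 ≤ p := by
    by_contra hp
    have hp' : p = 0 ∨ p = 1 := by omega
    rcases hp' with rfl | rfl
    · exact hne (congrArg Subtype.val (hf0.symm.trans hfp))
    · have := (hf 0 1 (by omega) le_rfl).2.mpr rfl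
      rw [hf0, hfp] at this
      exact hadj this
  refine ⟨p, fun i => (f i).1, hp, by simp [hf0], by simp [hfp], fun i hi hip => ?_,
    fun i j hij hj => ⟨fun h => (hf i j hij hj).1 (Subtype.ext h), (hf i j hij hj).2⟩⟩
  rcases (f i).2 with h | h | h
  · exact h
  · exact absurd (hf0.trans (Subtype.ext h.symm)) (hf 0 i hi hip.le).1
  · exact absurd ((Subtype.ext h : f i = ⟨t, htW⟩).trans hfp.symm) (hf i p hip le_rfl).1

theorem nonempty_cycleGraph_embedding {G : SimpleGraph V} {n : ℕ} (hn : 3 ≤ n) (g : ℕ → V)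
    (hg : ∀ i j, i < j → j < n →
      g i ≠ g j ∧ (G.Adj (g i) (g j) ↔ j = i + 1 ∨ i = 0 ∧ j = n - 1)) :
    Nonempty (cycleGraph n ↪g G) := by
  have hinj : Function.Injective fun i : Fin n => g i := by
    intro i j hij
    rcases lt_trichotomy i.1 j.1 with h | h | h
    · exact absurd hij (hg i j h j.2).1
    · exact Fin.ext h
    · exact absurd hij.symm (hg j i h i.2).1
  have hlt : ∀ i j : Fin n, i.1 < j.1 → (G.Adj (g i) (g j) ↔ (cycleGraph n).Adj i j) := by
    intro i j h
    rw [(hg i j h j.2).2, cycleGraph_adj', Fin.coe_sub_iff_lt.mpr h,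
      Fin.coe_sub_iff_le.mpr (Fin.le_def.mpr h.le)]
    omega
  refine ⟨⟨⟨fun i => g i, hinj⟩, fun {i j} => ?_⟩⟩
  change G.Adj (g i) (g j) ↔ _
  rcases lt_trichotomy i.1 j.1 with h | h | h
  · exact hlt i j h
  · obtain rfl := Fin.ext h
    simp
  · rw [G.adj_comm, (cycleGraph n).adj_comm]
    exact hlt j i h

theorem IsChordal.isClique_of_isMVS {G : SimpleGraph V} (hG : IsChordal G) {S : Set V}
    (hS : IsMVS G S) : G.IsClique S := by
  obtain ⟨u, v, -, -, hsep, hmin⟩ := hS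
  intro s hs t ht hne
  by_contra hadj
  obtain ⟨p, f, hp, hf0, hfp, hfC, hf⟩ :=
    exists_induced_path_through_componentAvoiding hsep hmin hs ht hne hadj
  obtain ⟨q, k, hq, hk0, hkq, hkC, hk⟩ :=
    exists_induced_path_through_componentAvoiding hsep.symm
      (fun T hT h => hmin T hT h.symm) hs ht hne hadj
  have hdisj : ∀ x ∈ componentAvoiding G S u, x ∉ componentAvoiding G S v := by
    rintro x ⟨hu, hx, h1⟩ ⟨hv, _, h2⟩
    obtain ⟨_, _, hr⟩ := hsep
    exact hr (h1.trans h2.symm)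
  obtain ⟨e⟩ := nonempty_cycleGraph_embedding (G := G) (n := p + q) (by omega)
    (fun i => if i ≤ p then f i else k (p + q - i)) (by
      intro i j hij hj
      by_cases hjp : j ≤ p
      · rw [if_pos (by omega), if_pos hjp, (hf i j hij hjp).2]
        exact ⟨(hf i j hij hjp).1, by omega⟩
      · rw [if_neg hjp]
        by_cases hip : i ≤ p
        · rw [if_pos hip]
          rcases Nat.eq_zero_or_pos i with rfl | hi
          · have := hk 0 (p + q - j) (by omega) (by omega)
            rw [hf0, ← hk0, this.2]
            exact ⟨this.1, by omega⟩
          · rcases hip.eq_or_lt with rfl | hip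
            · have := hk (i + q - j) q (by omega) le_rfl
              rw [hfp, ← hkq, G.adj_comm, this.2]
              exact ⟨this.1.symm, by omega⟩
            · have hi' := hfC i hi hip
              have hj' := hkC (p + q - j) (by omega) (by omega)
              refine ⟨fun h => hdisj _ hi' (h ▸ hj'), fun h => ?_, by omega⟩
              obtain ⟨_, hjS, _⟩ := id hj'
              exact absurd hj' (hdisj _ (mem_componentAvoiding_of_adj hi' hjS h))
        · rw [if_neg hip]
          have := hk (p + q - j) (p + q - i) (by omega) (by omega)
          rw [G.adj_comm, this.2]
          exact ⟨this.1.symm, by omega⟩)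
  exact (hG (p + q) (by omega)).false e

theorem StrictlyChordal.exists_reachable_adj_all [Finite V] {G : SimpleGraph V}
    (hG : StrictlyChordal G) {S : Set V} (hS : IsMVS G S) (c : (Sᶜ : Set V)) :
    ∃ d : (Sᶜ : Set V), (G.induce Sᶜ).Reachable c d ∧ ∀ t ∈ S, G.Adj d t := by
  obtain ⟨s, hs⟩ := hS.nonempty hG.1
  obtain ⟨p⟩ := hG.1.preconnected c s
  obtain ⟨d, hd, t, ht, hdt⟩ := exists_reachable_adj_of_walk p hs c.2
  refine ⟨d, hd, fun t' ht' => ?_⟩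
  by_contra hadj
  have htt : t ≠ t' := fun h => hadj (h ▸ hdt)
  obtain ⟨_, hmem, _⟩ := hG.separatedBy_of_adj hS (fun h : d.1 = t' => d.2 (h ▸ ht')) hadj ht hdt
    (hG.2.1.isClique_of_isMVS hS ht ht' htt)
  exact hmem ht'

theorem IsMaxClique.exists_not_adj {G : SimpleGraph V} {P Q : Set V} (hP : IsMaxClique G P)
    (hQ : IsMaxClique G Q) (hne : P ≠ Q) :
    ∃ x ∈ P, ∃ y ∈ Q, x ≠ y ∧ ¬ G.Adj x y := by
  by_contra! h
  have hPQ : G.IsClique (P ∪ Q) := by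
    rintro x (hx | hx) y (hy | hy) hxy
    · exact hP.1 hx hy hxy
    · exact h x hx y hy hxy
    · exact (h y hy x hx hxy.symm).symm
    · exact hQ.1 hx hy hxy
  exact hne ((hP.2 _ hPQ Set.subset_union_left).trans (hQ.2 _ hPQ Set.subset_union_right).symm)

theorem SimpleGraph.IsClique.exists_isMaxClique [Finite V] {G : SimpleGraph V} {K : Set V}
    (hK : G.IsClique K) : ∃ Q, IsMaxClique G Q ∧ K ⊆ Q := by
  obtain ⟨Q, hKQ, hQ⟩ := Finite.exists_le_maximal (p := fun R : Set V => G.IsClique R) hK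
  exact ⟨Q, ⟨hQ.prop, fun R hR hQR => hQ.eq_of_le hR hQR⟩, hKQ⟩

theorem SimpleGraph.IsClique.reachable_induce_compl {G : SimpleGraph V} {Q S : Set V}
    (hQ : G.IsClique Q) {x y : (Sᶜ : Set V)} (hx : x.1 ∈ Q) (hy : y.1 ∈ Q) :
    (G.induce Sᶜ).Reachable x y := by
  rcases eq_or_ne x y with rfl | hne
  · exact .rfl
  · have h : (G.induce Sᶜ).Adj x y := hQ hx hy (fun h => hne (Subtype.ext h))
    exact h.reachable

theorem StrictlyChordal.isClique_insert [Finite V] {G : SimpleGraph V} (hG : StrictlyChordal G)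
    {S : Set V} (hS : IsMVS G S) {d : V} (hd : ∀ t ∈ S, G.Adj d t) :
    G.IsClique (insert d S) :=
  (hG.2.1.isClique_of_isMVS hS).insert fun t ht _ => hd t ht

theorem StrictlyChordal.exists_mem_compl [Finite V] {G : SimpleGraph V} (hG : StrictlyChordal G)
    {S : Set V} (hS : IsMVS G S) {Q : Set V} (hQ : IsMaxClique G Q) (hSQ : S ⊆ Q) :
    ∃ x : (Sᶜ : Set V), x.1 ∈ Q := by
  by_contra! h
  have hQS : Q = S := Set.Subset.antisymm (fun x hx => by_contra fun hxS => h ⟨x, hxS⟩ hx) hSQ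
  subst hQS
  obtain ⟨u, _, _, _, ⟨hu, _⟩, _⟩ := id hS
  obtain ⟨d, _, hd⟩ := hG.exists_reachable_adj_all hS ⟨u, hu⟩
  have := hQ.2 _ (hG.isClique_insert hS hd) (Set.subset_insert _ _)
  exact d.2 (this.symm.subset (Set.mem_insert _ _))

theorem statement7 {V : Type*} [Finite V] (G : SimpleGraph V)
    (hsc : StrictlyChordal G) (S : Set V) (hS : IsMVS G S) :
    numComp G S = Nat.card {Q : Set V // IsMaxClique G Q ∧ S ⊆ Q} := by
  choose x hx using fun Q : {Q : Set V // IsMaxClique G Q ∧ S ⊆ Q} =>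
    hsc.exists_mem_compl hS Q.2.1 Q.2.2
  refine (Nat.card_eq_of_bijective
    (fun Q => (G.induce Sᶜ).connectedComponentMk (x Q)) ⟨fun P Q hPQ => ?_, fun C => ?_⟩).symm
  · by_contra hne
    obtain ⟨a, ha, b, hb, hab, hadj⟩ :=
      P.2.1.exists_not_adj Q.2.1 (fun h => hne (Subtype.ext h))
    obtain ⟨s, hs⟩ := hS.nonempty hsc.1
    have hsa : G.Adj a s := by
      refine P.2.1.1 ha (P.2.2 hs) ?_
      rintro rfl
      exact hadj (Q.2.1.1 (Q.2.2 hs) hb hab)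
    have hsb : G.Adj s b := by
      refine Q.2.1.1 (Q.2.2 hs) hb ?_
      rintro rfl
      exact hadj hsa
    obtain ⟨haS, hbS, hr⟩ := hsc.separatedBy_of_adj hS hab hadj hs hsa hsb
    exact hr ((P.2.1.1.reachable_induce_compl ha (hx P)).trans
      ((ConnectedComponent.exact hPQ).trans (Q.2.1.1.reachable_induce_compl (hx Q) hb)))
  · induction C using ConnectedComponent.ind with
    | _ c =>
      obtain ⟨d, hcd, hd⟩ := hsc.exists_reachable_adj_all hS c
      obtain ⟨Q, hQ, hdQ⟩ := (hsc.isClique_insert hS hd).exists_isMaxClique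
      let Q' : {Q : Set V // IsMaxClique G Q ∧ S ⊆ Q} :=
        ⟨Q, hQ, (Set.subset_insert _ _).trans hdQ⟩
      refine ⟨Q', ConnectedComponent.sound ?_⟩
      exact (hQ.1.reachable_induce_compl (hx Q') (hdQ (Set.mem_insert _ _))).trans hcd.symm
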